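/- Let (R,𝔪) be a Cohen-Macaulay local ring with canonical module that is generically Gorenstein, let ω be a canonical ideal of R, and let x ∈ ω be an R-regular element. Then exactly one of the following holds: (1) X_{ω²} ≅ X_{ω²/xω} and ω ⊕ Y_{ω²} ≅ Y_{ω²/xω}; (2) X_{ω²} ≅ ω ⊕ X_{ω²/xω} and Y_{ω²} ≅ Y_{ω²/xω}. Here 0 → Y_M → X_M → M → 0 denotes the minimal MCM approximation of M. -/

import Mathlib

open CategoryTheory

noncomputable section

/-- The Ext module `Ext^n_R(M, N)` for `R`-modules `M`, `N`. -/
abbrev ModExt (R : Type) [CommRing R] (n : ℕ) (M N : ModuleCat R) : ModuleCat R :=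
  ((Ext R (ModuleCat R) n).obj (Opposite.op M)).obj N

/-- An `R`-module `M` has finite injective dimension if `Ext^i_R(-, M)` vanishes
for all `i` beyond some bound. -/
def HasFiniteInjDim (R : Type) [CommRing R] (M : ModuleCat R) : Prop :=
  ∃ n : ℕ, ∀ (N : ModuleCat R) (i : ℕ), n < i → Subsingleton (ModExt R i N M)

/-- The depth of a module over a local ring, via Rees' characterization:
the least `n` with `Ext^n(k, M) ≠ 0`. -/
def moduleDepth (R : Type) [CommRing R] [IsLocalRing R] (M : ModuleCat R) : ℕ∞ :=
  sInf {n : ℕ∞ | ∃ m : ℕ, n = (m : ℕ∞) ∧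
    Nontrivial (ModExt R m (ModuleCat.of R (IsLocalRing.ResidueField R)) M)}

/-- A Noetherian local ring is Cohen-Macaulay if its depth equals its Krull dimension. -/
def IsCMLocalRing (R : Type) [CommRing R] [IsLocalRing R] : Prop :=
  IsNoetherianRing R ∧
    (moduleDepth R (ModuleCat.of R R) : WithBot ℕ∞) = ringKrullDim R

/-- A maximal Cohen-Macaulay module: finitely generated with depth equal to `dim R`. -/
def IsMCM (R : Type) [CommRing R] [IsLocalRing R] (X : ModuleCat R) : Prop :=
  Module.Finite R X ∧ (moduleDepth R X : WithBot ℕ∞) = ringKrullDim R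

/-- A Cohen-Macaulay module of codimension one:
`depth M = dim M = dim R - 1`. -/
def IsCMofCodimOne (R : Type) [CommRing R] [IsLocalRing R] (M : ModuleCat R) : Prop :=
  Module.Finite R M ∧ ∃ d : ℕ, ringKrullDim R = ((d + 1 : ℕ) : WithBot ℕ∞) ∧
    moduleDepth R M = (d : ℕ∞) ∧
    ringKrullDim (R ⧸ Module.annihilator R M) = ((d : ℕ) : WithBot ℕ∞)

/-- A Gorenstein local ring: Noetherian local with finite injective dimension over itself. -/
def IsGorensteinLocalRing (A : Type) [CommRing A] : Prop :=
  IsNoetherianRing A ∧ IsLocalRing A ∧ HasFiniteInjDim A (ModuleCat.of A A)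

/-- `R` is generically Gorenstein if its localization at every minimal prime is Gorenstein. -/
def IsGenericallyGorenstein (R : Type) [CommRing R] : Prop :=
  ∀ p ∈ minimalPrimes R, ∀ h : p.IsPrime,
    letI := h
    IsGorensteinLocalRing (Localization.AtPrime p)

/-- A canonical module of a local ring `R`: finitely generated, of finite injective
dimension, with `Ext^i(k, ω) ≅ k` for `i = dim R` and `Ext^i(k, ω) = 0` otherwise. -/
def IsCanonicalModule (R : Type) [CommRing R] [IsLocalRing R] (W : ModuleCat R) : Prop :=
  Module.Finite R W ∧ HasFiniteInjDim R W ∧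
    ∃ d : ℕ, ringKrullDim R = (d : ℕ) ∧
      Nonempty ((ModExt R d (ModuleCat.of R (IsLocalRing.ResidueField R)) W) ≃ₗ[R]
        IsLocalRing.ResidueField R) ∧
      ∀ i : ℕ, i ≠ d →
        Subsingleton (ModExt R i (ModuleCat.of R (IsLocalRing.ResidueField R)) W)

/-- A canonical ideal: an ideal of `R` which, as an `R`-module, is a canonical module. -/
def IsCanonicalIdeal (R : Type) [CommRing R] [IsLocalRing R] (I : Ideal R) : Prop :=
  IsCanonicalModule R (ModuleCat.of R I)

/-- `Y` and `X` have a common nonzero direct summand via the map `ι : Y → X`. -/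
def HasCommonSummandVia (R : Type) [CommRing R] {Y X : ModuleCat R}
    (ι : Y →ₗ[R] X) : Prop :=
  ∃ (N Y' X' : ModuleCat.{0} R), Nontrivial N ∧
    ∃ (e : Y ≃ₗ[R] N × Y') (f : X ≃ₗ[R] N × X') (ι' : Y' →ₗ[R] X'),
      ∀ y : Y, f (ι y) = ((e y).1, ι' (e y).2)

/-- `0 → Y → X → M → 0` is an MCM approximation of `M`. -/
def IsMCMApprox (R : Type) [CommRing R] [IsLocalRing R] (M Y X : ModuleCat R)
    (ι : Y →ₗ[R] X) (π : X →ₗ[R] M) : Prop :=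
  Module.Finite R M ∧ Module.Finite R Y ∧ IsMCM R X ∧ HasFiniteInjDim R Y ∧
    Function.Injective ι ∧ Function.Surjective π ∧ Function.Exact ι π

/-- `0 → Y → X → M → 0` is a minimal MCM approximation of `M`. -/
def IsMinMCMApprox (R : Type) [CommRing R] [IsLocalRing R] (M Y X : ModuleCat R)
    (ι : Y →ₗ[R] X) (π : X →ₗ[R] M) : Prop :=
  IsMCMApprox R M Y X ι π ∧ ¬ HasCommonSummandVia R ι

/-- `0 → M → Y → X → 0` is an FID hull of `M`. -/
def IsFIDHull (R : Type) [CommRing R] [IsLocalRing R] (M Y X : ModuleCat R)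
    (ι : M →ₗ[R] Y) (π : Y →ₗ[R] X) : Prop :=
  Module.Finite R M ∧ Module.Finite R Y ∧ HasFiniteInjDim R Y ∧
    (IsMCM R X ∨ Subsingleton X) ∧
    Function.Injective ι ∧ Function.Surjective π ∧ Function.Exact ι π

/-- `0 → M → Y → X → 0` is a minimal FID hull of `M`. -/
def IsMinFIDHull (R : Type) [CommRing R] [IsLocalRing R] (M Y X : ModuleCat R)
    (ι : M →ₗ[R] Y) (π : Y →ₗ[R] X) : Prop :=
  IsFIDHull R M Y X ι π ∧ ¬ HasCommonSummandVia R π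

/-- The free rank of a module: the largest `m` with `R^m` a direct summand. -/
def freeRank (R : Type) [CommRing R] (X : ModuleCat R) : ℕ∞ :=
  sSup {n : ℕ∞ | ∃ m : ℕ, n = (m : ℕ∞) ∧
    ∃ X' : ModuleCat.{0} R, Nonempty (X ≃ₗ[R] ((Fin m → R) × X'))}

/-- The `W`-rank of a module: the largest `m` with `W^m` a direct summand. -/
def wRank (R : Type) [CommRing R] (W X : ModuleCat R) : ℕ∞ :=
  sSup {n : ℕ∞ | ∃ m : ℕ, n = (m : ℕ∞) ∧
    ∃ X' : ModuleCat.{0} R, Nonempty (X ≃ₗ[R] ((Fin m → W) × X'))}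

/-- `M` and `N` are `W`-stably isomorphic. -/
def WStablyIso (R : Type) [CommRing R] (W M N : ModuleCat R) : Prop :=
  ∃ s t : ℕ, Nonempty ((M × (Fin s → W)) ≃ₗ[R] (N × (Fin t → W)))

/-- The quotient module `I/J` (realized as `I` modulo the elements of `J` lying in `I`). -/
abbrev qmod (R : Type) [CommRing R] (I J : Ideal R) : ModuleCat R :=
  ModuleCat.of R (I ⧸ (Submodule.comap I.subtype J))

/-- The degree `n` cocycles of `Hom(P, N)`. -/
abbrev extCocycles {R : Type} [CommRing R] {M : ModuleCat.{0} R} (P : ProjectiveResolution M)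
    (N : ModuleCat.{0} R) (n : ℕ) : Submodule R (P.complex.X n ⟶ N) :=
  LinearMap.ker (Linear.leftComp R N (P.complex.d (n + 1) n))

theorem d_comp_extCocycles {R : Type} [CommRing R] {M : ModuleCat.{0} R}
    {P : ProjectiveResolution M} {N : ModuleCat.{0} R} {n : ℕ} (f : extCocycles P N n) :
    P.complex.d (n + 1) n ≫ f.1 = 0 := f.2

/-- The class in `Ext` of a cocycle on a projective resolution, as a linear map. -/
def extOfCocycle {R : Type} [CommRing R] {M : ModuleCat.{0} R} (P : ProjectiveResolution M)
    (N : ModuleCat.{0} R) (n : ℕ) : extCocycles P N n →ₗ[R] Abelian.Ext M N n where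
  toFun f := P.extMk f.1 (n + 1) rfl (d_comp_extCocycles f)
  map_add' f g := (P.add_extMk _ _ _ _ _ _).symm
  map_smul' r f := by
    rw [RingHom.id_apply, Abelian.Ext.smul_eq_comp_mk₀, P.extMk_comp_mk₀]
    congr 1

theorem extOfCocycle_surjective {R : Type} [CommRing R] {M : ModuleCat.{0} R}
    (P : ProjectiveResolution M) (N : ModuleCat.{0} R) (n : ℕ) :
    Function.Surjective (extOfCocycle P N n) := by
  intro α
  obtain ⟨f, hf, rfl⟩ := P.extMk_surjective α (n + 1) rfl
  exact ⟨⟨f, hf⟩, rfl⟩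

theorem extOfCocycle_eq_zero_iff {R : Type} [CommRing R] {M : ModuleCat.{0} R}
    (P : ProjectiveResolution M) (N : ModuleCat.{0} R) (n : ℕ) (f : extCocycles P N n) :
    extOfCocycle P N n f = 0 ↔
      ∃ g : P.complex.X ((ComplexShape.up ℕ).prev n) ⟶ N,
        P.complex.d n ((ComplexShape.up ℕ).prev n) ≫ g = f.1 := by
  cases n with
  | zero =>
    have h0 : P.complex.d 0 ((ComplexShape.up ℕ).prev 0) = 0 :=
      P.complex.shape _ _ (by simp)
    simp only [h0, Limits.zero_comp, exists_const]
    change P.extMk f.1 (0 + 1) rfl (d_comp_extCocycles f) = 0 ↔ _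
    rw [← P.extEquivCohomologyClass.apply_eq_iff_eq, P.extEquivCohomologyClass_extMk,
      P.extEquivCohomologyClass_zero, CochainComplex.HomComplex.CohomologyClass.mk_eq_zero_iff,
      CochainComplex.HomComplex.Cocycle.toSingleMk_mem_coboundaries_iff _ _ _ _ _ 1 (by simp)]
    have h1 : P.cochainComplex.d (-((0 : ℕ) : ℤ)) 1 = 0 :=
      (P.cochainComplex.isZero_of_isStrictlyLE 0 1 (by simp)).eq_of_tgt _ _
    simp only [h1, Limits.zero_comp, exists_const]
    rw [← cancel_epi (P.cochainComplexXIso (-((0 : ℕ) : ℤ)) 0 rfl).hom, Limits.comp_zero]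
  | succ p =>
    have hp : (ComplexShape.up ℕ).prev (p + 1) = p := by simp
    rw [hp]
    exact P.extMk_eq_zero_iff f.1 (p + 2) rfl (d_comp_extCocycles f) p rfl

/-- The derived functor `Ext` is linearly equivalent to the `Ext` of the derived category. -/
def modExtEquiv {R : Type} [CommRing R] (n : ℕ) (M N : ModuleCat.{0} R) :
    ModExt R n M N ≃ₗ[R] Abelian.Ext M N n :=
  let P := projectiveResolution M
  let K := P.complex.linearYonedaObj R N
  let S := K.sc' ((ComplexShape.up ℕ).prev n) n (n + 1)
  (P.isoExt n N ≪≫ ShortComplex.homologyMapIso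
      (K.isoSc' _ n (n + 1) rfl (by simp)) ≪≫ S.moduleCatHomologyIso).toLinearEquiv.trans
    ((Submodule.quotEquivOfEq (p := LinearMap.range S.moduleCatToCycles)
      (p' := LinearMap.ker (extOfCocycle P N n)) (by
      ext f
      refine Iff.trans ?_ (extOfCocycle_eq_zero_iff P N n f).symm
      constructor
      · rintro ⟨x, rfl⟩
        exact ⟨x, rfl⟩
      · rintro ⟨x, hx⟩
        exact ⟨x, Subtype.ext hx⟩)).trans
    ((extOfCocycle P N n).quotKerEquivOfSurjective (extOfCocycle_surjective P N n)))

section ExtMaps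

variable {R : Type} [CommRing R]

/-- The map on `Ext` induced by a map in the second argument. -/
def extPush {Y Z : ModuleCat.{0} R} (g : Y ⟶ Z) {N : ModuleCat.{0} R} {i : ℕ} :
    Abelian.Ext N Y i →ₗ[R] Abelian.Ext N Z i :=
  (Abelian.Ext.mk₀ g).postcompOfLinear R N (add_zero i)

/-- The map on `Ext` induced by a map in the first argument. -/
def extPull {M N : ModuleCat.{0} R} (f : M ⟶ N) {Y : ModuleCat.{0} R} {i : ℕ} :
    Abelian.Ext N Y i →ₗ[R] Abelian.Ext M Y i :=
  (Abelian.Ext.mk₀ f).precompOfLinear R Y (zero_add i)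

theorem extPush_def {Y Z : ModuleCat.{0} R} (g : Y ⟶ Z) {N : ModuleCat.{0} R} {i : ℕ}
    (a : Abelian.Ext N Y i) :
    extPush g a = a.comp (Abelian.Ext.mk₀ g) (add_zero i) := rfl

theorem extPull_def {M N : ModuleCat.{0} R} (f : M ⟶ N) {Y : ModuleCat.{0} R} {i : ℕ}
    (a : Abelian.Ext N Y i) :
    extPull f a = (Abelian.Ext.mk₀ f).comp a (zero_add i) := rfl

theorem extPush_comp {X Y Z N : ModuleCat.{0} R} (f : X ⟶ Y) (g : Y ⟶ Z) {i : ℕ}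
    (a : Abelian.Ext N X i) : extPush (f ≫ g) a = extPush g (extPush f a) := by
  rw [extPush_def, extPush_def, extPush_def, Abelian.Ext.comp_assoc_of_third_deg_zero,
    Abelian.Ext.mk₀_comp_mk₀]

@[simp]
theorem extPush_id {Y N : ModuleCat.{0} R} {i : ℕ} (a : Abelian.Ext N Y i) :
    extPush (𝟙 Y) a = a := by
  rw [extPush_def, Abelian.Ext.comp_mk₀_id]

@[simp]
theorem extPush_zero {Y Z N : ModuleCat.{0} R} {i : ℕ} (a : Abelian.Ext N Y i) :
    extPush (0 : Y ⟶ Z) a = 0 := by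
  rw [extPush_def, Abelian.Ext.mk₀_zero, Abelian.Ext.comp_zero]

theorem extPush_add {Y Z N : ModuleCat.{0} R} (f g : Y ⟶ Z) {i : ℕ} (a : Abelian.Ext N Y i) :
    extPush (f + g) a = extPush f a + extPush g a := by
  rw [extPush_def, Abelian.Ext.mk₀_add, Abelian.Ext.comp_add, extPush_def, extPush_def]

theorem extPull_smul_id {N Y : ModuleCat.{0} R} (y : R) {i : ℕ} (a : Abelian.Ext N Y i) :
    extPull (y • 𝟙 N) a = y • a := by
  rw [extPull_def, Abelian.Ext.mk₀_smul, Abelian.Ext.smul_comp, Abelian.Ext.mk₀_id_comp]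

theorem extPush_smul_id {N Y : ModuleCat.{0} R} (y : R) {i : ℕ} (a : Abelian.Ext N Y i) :
    extPush (y • 𝟙 Y) a = y • a := by
  rw [extPush_def, Abelian.Ext.mk₀_smul, Abelian.Ext.comp_smul, Abelian.Ext.comp_mk₀_id]

@[simp]
theorem extPull_id {N Y : ModuleCat.{0} R} {i : ℕ} (a : Abelian.Ext N Y i) :
    extPull (𝟙 N) a = a := by
  rw [extPull_def, Abelian.Ext.mk₀_id_comp]

theorem extPush_extPull {M N Y Z : ModuleCat.{0} R} (f : M ⟶ N) (g : Y ⟶ Z) {i : ℕ}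
    (a : Abelian.Ext N Y i) : extPush g (extPull f a) = extPull f (extPush g a) := by
  rw [extPush_def, extPull_def, extPull_def, extPush_def,
    Abelian.Ext.comp_assoc_of_third_deg_zero]

/-- A short exact sequence of modules, elementwise. -/
structure ShortExactPair {A B C : ModuleCat.{0} R} (f : A ⟶ B) (g : B ⟶ C) : Prop where
  inj : Function.Injective f
  surj : Function.Surjective g
  exact : Function.Exact f g

namespace ShortExactPair

variable {A B C : ModuleCat.{0} R} {f : A ⟶ B} {g : B ⟶ C}

theorem comp_eq_zero (h : ShortExactPair f g) : f ≫ g = 0 :=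
  ModuleCat.hom_ext (LinearMap.ext fun a => h.exact.apply_apply_eq_zero a)

theorem shortExact (h : ShortExactPair f g) :
    (ShortComplex.mk f g h.comp_eq_zero).ShortExact where
  exact := (ShortComplex.ShortExact.moduleCat_exact_iff_function_exact _).mpr h.exact
  mono_f := (ModuleCat.mono_iff_injective _).mpr h.inj
  epi_g := (ModuleCat.epi_iff_surjective _).mpr h.surj

/-- The contravariant connecting map. -/
def del (h : ShortExactPair f g) {Y : ModuleCat.{0} R} {i : ℕ} :
    Abelian.Ext A Y i →ₗ[R] Abelian.Ext C Y (i + 1) :=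
  h.shortExact.extClass.precompOfLinear R Y (add_comm 1 i)

/-- The covariant connecting map. -/
def codel (h : ShortExactPair f g) {X : ModuleCat.{0} R} {i : ℕ} :
    Abelian.Ext X C i →ₗ[R] Abelian.Ext X A (i + 1) :=
  h.shortExact.extClass.postcompOfLinear R X rfl

theorem extPush_del (h : ShortExactPair f g) {Y Z : ModuleCat.{0} R} (u : Y ⟶ Z) {i : ℕ}
    (a : Abelian.Ext A Y i) : extPush u (h.del a) = h.del (extPush u a) :=
  Abelian.Ext.comp_assoc_of_third_deg_zero _ _ _ (add_comm 1 i)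

theorem codel_comp (h : ShortExactPair f g) {X Y : ModuleCat.{0} R} {i j l : ℕ}
    (c : Abelian.Ext X C j) (a : Abelian.Ext A Y i) (hl : j + 1 + i = l) :
    (h.codel c).comp a hl = c.comp (h.del a) (by omega) :=
  Abelian.Ext.comp_assoc _ _ _ rfl (add_comm 1 i) (by omega)

theorem extPull_del (h : ShortExactPair f g) {Y : ModuleCat.{0} R} {i : ℕ}
    (a : Abelian.Ext A Y i) : extPull g (h.del a) = 0 := by
  have := Abelian.Ext.comp_assoc (Abelian.Ext.mk₀ g) h.shortExact.extClass a (zero_add 1)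
    (add_comm 1 i) (show 0 + 1 + i = i + 1 by omega)
  refine this.symm.trans ?_
  rw [h.shortExact.comp_extClass, Abelian.Ext.zero_comp]

theorem del_extPull (h : ShortExactPair f g) {Y : ModuleCat.{0} R} {i : ℕ}
    (b : Abelian.Ext B Y i) : h.del (extPull f b) = 0 := by
  have := Abelian.Ext.comp_assoc h.shortExact.extClass (Abelian.Ext.mk₀ f) b (add_zero 1)
    (zero_add i) (show 1 + 0 + i = i + 1 by omega)
  refine this.symm.trans ?_
  rw [h.shortExact.extClass_comp, Abelian.Ext.zero_comp]

theorem exists_extPush_eq (h : ShortExactPair f g) {X : ModuleCat.{0} R} {i : ℕ}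
    (b : Abelian.Ext X B i) (hb : extPush g b = 0) : ∃ a, extPush f a = b :=
  Abelian.Ext.covariant_sequence_exact₂ X h.shortExact b hb

theorem exists_codel_eq (h : ShortExactPair f g) {X : ModuleCat.{0} R} {i : ℕ}
    (a : Abelian.Ext X A (i + 1)) (ha : extPush f a = 0) :
    ∃ c : Abelian.Ext X C i, h.codel c = a :=
  Abelian.Ext.covariant_sequence_exact₁ X h.shortExact a ha rfl

theorem exists_extPush_eq_of_codel (h : ShortExactPair f g) {X : ModuleCat.{0} R} {i : ℕ}
    (c : Abelian.Ext X C i) (hc : h.codel c = 0) : ∃ b, extPush g b = c :=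
  Abelian.Ext.covariant_sequence_exact₃ X h.shortExact c rfl hc

theorem exists_extPull_eq (h : ShortExactPair f g) {Y : ModuleCat.{0} R} {i : ℕ}
    (b : Abelian.Ext B Y i) (hb : extPull f b = 0) : ∃ c, extPull g c = b :=
  Abelian.Ext.contravariant_sequence_exact₂ h.shortExact Y b hb

theorem exists_del_eq (h : ShortExactPair f g) {Y : ModuleCat.{0} R} {i : ℕ}
    (c : Abelian.Ext C Y (i + 1)) (hc : extPull g c = 0) :
    ∃ a : Abelian.Ext A Y i, h.del a = c :=
  Abelian.Ext.contravariant_sequence_exact₃ h.shortExact Y c hc (add_comm 1 i)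

theorem exists_extPull_eq_of_del (h : ShortExactPair f g) {Y : ModuleCat.{0} R} {i : ℕ}
    (a : Abelian.Ext A Y i) (ha : h.del a = 0) : ∃ b, extPull f b = a :=
  Abelian.Ext.contravariant_sequence_exact₁ h.shortExact Y a (add_comm 1 i) ha

theorem exists_lift (h : ShortExactPair f g) {X : ModuleCat.{0} R} (φ : X ⟶ C)
    (hX : Subsingleton (Abelian.Ext X A 1)) : ∃ ψ : X ⟶ B, ψ ≫ g = φ := by
  obtain ⟨b, hb⟩ := h.exists_extPush_eq_of_codel (Abelian.Ext.mk₀ φ) (Subsingleton.elim _ _)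
  refine ⟨Abelian.Ext.addEquiv₀ b, (Abelian.Ext.mk₀_bijective _ _).1 ?_⟩
  rw [← Abelian.Ext.mk₀_comp_mk₀, Abelian.Ext.mk₀_addEquiv₀_apply]
  exact hb

theorem of_isSMulRegular {N : ModuleCat.{0} R} {y : R} (h : IsSMulRegular N y) :
    ShortExactPair (y • 𝟙 N)
      (ModuleCat.ofHom (LinearMap.lsmul R N y).range.mkQ) where
  inj := h
  surj := Submodule.mkQ_surjective _
  exact := LinearMap.exact_map_mkQ_range (LinearMap.lsmul R N y)

theorem ker {A B : ModuleCat.{0} R} (g : A ⟶ B) (hg : Function.Surjective g) :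
    ShortExactPair (ModuleCat.ofHom (LinearMap.ker g.hom).subtype) g where
  inj := Subtype.val_injective
  surj := hg
  exact := LinearMap.exact_subtype_ker_map g.hom

end ShortExactPair

end ExtMaps

section Depth

variable {R : Type} [CommRing R]

/-- The Ext modules into `Y` from finitely generated modules vanish in degrees above `r`. -/
def ExtVanishAbove (Y : ModuleCat.{0} R) (r : ℕ) : Prop :=
  ∀ N : ModuleCat.{0} R, Module.Finite R N → ∀ i, r < i → Subsingleton (Abelian.Ext N Y i)

/-- The residue field as an object of the category of modules. -/
abbrev residueModule (R : Type) [CommRing R] [IsLocalRing R] : ModuleCat.{0} R :=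
  ModuleCat.of R (IsLocalRing.ResidueField R)

/-- The depth of `N`, measured by Ext from the residue field, is at least `j`. -/
def DepthGE [IsLocalRing R] (N : ModuleCat.{0} R) (j : ℕ) : Prop :=
  ∀ i < j, Subsingleton (Abelian.Ext (residueModule R) N i)

/-- Postcomposition with `g` is surjective on `Ext N - i`. -/
def ExtSurj {Y Z : ModuleCat.{0} R} (g : Y ⟶ Z) (N : ModuleCat.{0} R) (i : ℕ) : Prop :=
  Function.Surjective (extPush g : Abelian.Ext N Y i →ₗ[R] Abelian.Ext N Z i)

/-- Postcomposition with `g` is injective on `Ext N - i`. -/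
def ExtInj {Y Z : ModuleCat.{0} R} (g : Y ⟶ Z) (N : ModuleCat.{0} R) (i : ℕ) : Prop :=
  Function.Injective (extPush g : Abelian.Ext N Y i →ₗ[R] Abelian.Ext N Z i)

theorem surjective_of_extSurj {Y Z : ModuleCat.{0} R} (g : Y ⟶ Z)
    (h : ExtSurj g (ModuleCat.of R R) 0) : Function.Surjective g := by
  intro z
  obtain ⟨b, hb⟩ := h (Abelian.Ext.mk₀ (ModuleCat.ofHom (LinearMap.toSpanSingleton R Z z)))
  obtain ⟨f, rfl⟩ := (Abelian.Ext.mk₀_bijective _ _).2 b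
  rw [extPush_def, Abelian.Ext.mk₀_comp_mk₀] at hb
  have := ConcreteCategory.congr_hom ((Abelian.Ext.mk₀_bijective _ _).1 hb) (1 : R)
  exact ⟨f (1 : R), this.trans (one_smul R z)⟩

theorem nakayama_of_mem_maximalIdeal [IsLocalRing R] {A : Type} [AddCommGroup A] [Module R A]
    [Module.Finite R A] (U : Submodule R A) {y : R} (hy : y ∈ IsLocalRing.maximalIdeal R)
    (h : ∀ a : A, ∃ b : A, a - y • b ∈ U) : U = ⊤ := by
  rw [eq_top_iff]
  refine Submodule.le_of_le_smul_of_le_jacobson_bot (I := IsLocalRing.maximalIdeal R)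
    Module.Finite.fg_top (IsLocalRing.maximalIdeal_le_jacobson ⊥) fun a _ => ?_
  obtain ⟨b, hb⟩ := h a
  rw [← sub_add_cancel a (y • b)]
  exact Submodule.add_mem_sup hb (Submodule.smul_mem_smul hy trivial)

theorem smul_residue_ext_eq_zero [IsLocalRing R] {N : ModuleCat.{0} R} {j : ℕ}
    (ξ : Abelian.Ext (residueModule R) N j) {y : R} (hy : y ∈ IsLocalRing.maximalIdeal R) :
    y • ξ = 0 := by
  have h0 : y • 𝟙 (residueModule R) = 0 := by
    refine ModuleCat.hom_ext (LinearMap.ext fun t => ?_)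
    have : y • t = 0 := by
      rw [Algebra.smul_def, IsLocalRing.ResidueField.algebraMap_eq,
        (IsLocalRing.residue_eq_zero_iff y).mpr hy, zero_mul]
    exact this
  rw [← extPull_smul_id, h0, extPull_def, Abelian.Ext.mk₀_zero, Abelian.Ext.zero_comp]

theorem exists_regular_of_depthGE [IsNoetherianRing R] [IsLocalRing R] {N : ModuleCat.{0} R}
    [Module.Finite R N] {j : ℕ} (h : DepthGE N (j + 1)) :
    ∃ y ∈ IsLocalRing.maximalIdeal R, ∃ (C : ModuleCat.{0} R) (q : N ⟶ C), Module.Finite R C ∧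
      ShortExactPair (y • 𝟙 N) q ∧ DepthGE C j := by
  have : Subsingleton (residueModule R ⟶ N) :=
    Abelian.Ext.addEquiv₀.subsingleton_congr.mp (h 0 j.succ_pos)
  have : Subsingleton (IsLocalRing.ResidueField R →ₗ[R] N) :=
    (ModuleCat.homAddEquiv (M := residueModule R) (N := N)).symm.subsingleton
  obtain ⟨y, hy, hreg⟩ := IsSMulRegular.subsingleton_linearMap_iff.mp this
  have hym : y ∈ IsLocalRing.maximalIdeal R := by
    have h1 := Module.mem_annihilator.mp hy (1 : IsLocalRing.ResidueField R)
    rw [Algebra.smul_def, mul_one] at h1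
    exact (IsLocalRing.residue_eq_zero_iff y).mp h1
  have hS := ShortExactPair.of_isSMulRegular hreg
  refine ⟨y, hym, _, _, inferInstance, hS, fun i hi => subsingleton_of_forall_eq 0 fun α => ?_⟩
  have s1 := h i (by omega)
  have s2 := h (i + 1) (by omega)
  obtain ⟨β, hβ⟩ := hS.exists_extPush_eq_of_codel α (Subsingleton.elim _ _)
  rw [← hβ, Subsingleton.elim β 0, map_zero]

/-- The common inductive step for surjectivity on Ext modules. -/
theorem ExtSurj.of_regular [IsNoetherianRing R] [IsLocalRing R] {Y Z N C : ModuleCat.{0} R}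
    [Module.Finite R Z] [Module.Finite R N] (g : Y ⟶ Z) {y : R}
    (hy : y ∈ IsLocalRing.maximalIdeal R) {q : N ⟶ C} (hS : ShortExactPair (y • 𝟙 N) q) {i : ℕ}
    (hs : ExtSurj g C (i + 1)) (hi : ExtInj g N (i + 1)) : ExtSurj g N i := by
  refine LinearMap.range_eq_top.mp (nakayama_of_mem_maximalIdeal _ hy fun a => ?_)
  obtain ⟨b, hb⟩ := hs (hS.del a)
  have hb0 : extPull q b = 0 := hi (by
    rw [extPush_extPull, hb, hS.extPull_del, map_zero])
  obtain ⟨a', rfl⟩ := hS.exists_del_eq b hb0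
  obtain ⟨c, hc⟩ := hS.exists_extPull_eq_of_del (a - extPush g a') (by
    rw [map_sub, ← hS.extPush_del, hb, sub_self])
  refine ⟨c, a', ?_⟩
  rw [extPull_smul_id] at hc
  rw [hc, sub_sub_cancel]

theorem ext_subsingleton_of_regular [IsNoetherianRing R] [IsLocalRing R]
    {Y N C : ModuleCat.{0} R} [Module.Finite R Y] [Module.Finite R N] {y : R}
    (hy : y ∈ IsLocalRing.maximalIdeal R) {q : N ⟶ C} (hS : ShortExactPair (y • 𝟙 N) q) {i : ℕ}
    (hs : Subsingleton (Abelian.Ext C Y (i + 1))) :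
    Subsingleton (Abelian.Ext N Y i) := by
  refine (Submodule.subsingleton_iff R).mp (subsingleton_of_bot_eq_top
    (nakayama_of_mem_maximalIdeal _ hy fun a => ?_))
  obtain ⟨c, hc⟩ := hS.exists_extPull_eq_of_del a (Subsingleton.elim _ _)
  refine ⟨c, ?_⟩
  rw [Submodule.mem_bot, sub_eq_zero, ← hc, extPull_smul_id]

theorem ext_subsingleton_of_depthGE [IsNoetherianRing R] [IsLocalRing R] {Y : ModuleCat.{0} R}
    [Module.Finite R Y] {r : ℕ} (hY : ExtVanishAbove Y r) {j : ℕ} {N : ModuleCat.{0} R}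
    [Module.Finite R N] (hN : DepthGE N j) {i : ℕ} (hij : r < i + j) :
    Subsingleton (Abelian.Ext N Y i) := by
  induction j generalizing N i with
  | zero => exact hY N inferInstance i hij
  | succ j ih =>
    obtain ⟨y, hy, C, q, _, hS, hd⟩ := exists_regular_of_depthGE hN
    exact ext_subsingleton_of_regular hy hS (ih hd (by omega))

theorem injective_of_residueModule_hom_ne_zero [IsLocalRing R] {N : ModuleCat.{0} R}
    (f : residueModule R ⟶ N) (hf : f ≠ 0) : Function.Injective f := by
  refine (injective_iff_map_eq_zero f.hom).mpr fun t ht => ?_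
  by_contra ht0
  refine hf (ModuleCat.hom_ext (LinearMap.ext fun s => ?_))
  obtain ⟨c, hc⟩ := IsLocalRing.residue_surjective (R := R) (s * (t : IsLocalRing.ResidueField R)⁻¹)
  have hs : s = c • t := by
    rw [Algebra.smul_def, IsLocalRing.ResidueField.algebraMap_eq, hc]
    exact (inv_mul_cancel_right₀ (a := (s : IsLocalRing.ResidueField R)) ht0).symm
  rw [hs, map_smul, ht, smul_zero]
  rfl

theorem exists_comp_eq_of_depthGE [IsNoetherianRing R] [IsLocalRing R] {Y : ModuleCat.{0} R}
    [Module.Finite R Y] {r : ℕ} (hY : ExtVanishAbove Y r) {j : ℕ} {N : ModuleCat.{0} R}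
    [Module.Finite R N] (hN : DepthGE N j) {ξ : Abelian.Ext (residueModule R) N j} (hξ : ξ ≠ 0)
    {i : ℕ} (hij : j + i = r) (η : Abelian.Ext (residueModule R) Y r) :
    ∃ β : Abelian.Ext N Y i, ξ.comp β hij = η := by
  induction j generalizing N i with
  | zero =>
    obtain ⟨f, rfl⟩ := (Abelian.Ext.mk₀_bijective _ _).2 ξ
    obtain rfl : i = r := by omega
    have hf : f ≠ 0 := by
      rintro rfl
      exact hξ (Abelian.Ext.mk₀_zero _ _)
    have hS : ShortExactPair f (ModuleCat.ofHom f.hom.range.mkQ) :=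
      ⟨injective_of_residueModule_hom_ne_zero f hf, Submodule.mkQ_surjective _,
        LinearMap.exact_map_mkQ_range _⟩
    have := hY (ModuleCat.of R (N ⧸ f.hom.range)) inferInstance (i + 1) (by omega)
    exact hS.exists_extPull_eq_of_del η (Subsingleton.elim _ _)
  | succ j ih =>
    obtain ⟨y, hy, C, q, _, hS, hd⟩ := exists_regular_of_depthGE hN
    obtain ⟨ξ', rfl⟩ := hS.exists_codel_eq ξ (by
      rw [extPush_smul_id, smul_residue_ext_eq_zero ξ hy])
    obtain ⟨β', hβ'⟩ := ih hd (ξ := ξ') (by rintro rfl; exact hξ (map_zero _))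
      (i := i + 1) (by omega)
    have := ext_subsingleton_of_depthGE hY hN (i := i + 1) (by omega)
    obtain ⟨β, rfl⟩ := hS.exists_del_eq β' (Subsingleton.elim _ _)
    exact ⟨β, (hS.codel_comp _ _ _).trans hβ'⟩

end Depth

section Devissage

variable {R : Type} [CommRing R] [IsLocalRing R] [IsNoetherianRing R]

/-- Induction for finitely generated modules over a local ring: besides the residue field, it
suffices to treat modules admitting a regular element of the maximal ideal. -/
theorem finite_module_induction {P : ModuleCat.{0} R → Prop}
    (subsingleton : ∀ N : ModuleCat.{0} R, Subsingleton N → P N)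
    (residue : P (residueModule R))
    (regular : ∀ N : ModuleCat.{0} R, Module.Finite R N → ∀ y ∈ IsLocalRing.maximalIdeal R,
      IsSMulRegular N y → P N)
    (extension : ∀ (N₁ N₂ N₃ : ModuleCat.{0} R) (f : N₁ ⟶ N₂) (g : N₂ ⟶ N₃),
      ShortExactPair f g → P N₁ → P N₃ → P N₂)
    (N : ModuleCat.{0} R) [Module.Finite R N] : P N := by
  refine IsNoetherianRing.induction_on_isQuotientEquivQuotientPrime (A := R) (M := N) ‹_›
    (motive := fun N _ _ _ => P (ModuleCat.of R N)) ?_ ?_ ?_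
  · intro N _ _ _ _
    exact subsingleton _ ‹_›
  · intro N _ _ _ p e
    by_cases hp : p.1 = IsLocalRing.maximalIdeal R
    · let e' : N ≃ₗ[R] IsLocalRing.ResidueField R :=
        e.trans (Submodule.quotEquivOfEq p.1 (IsLocalRing.maximalIdeal R) hp)
      refine extension (residueModule R) (ModuleCat.of R N) (ModuleCat.of R PUnit)
        (ModuleCat.ofHom e'.symm.toLinearMap) (ModuleCat.ofHom 0)
        ⟨e'.symm.injective, Function.surjective_to_subsingleton _, ?_⟩ residue
        (subsingleton _ inferInstance)
      exact (LinearMap.exact_zero_iff_surjective _ _).mpr e'.symm.surjective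
    · obtain ⟨y, hy, hyp⟩ := Set.not_subset.mp fun hle =>
        hp (le_antisymm (IsLocalRing.le_maximalIdeal p.2.ne_top) hle)
      refine regular _ ‹_› y hy ?_
      have : IsDomain (R ⧸ p.1) := Ideal.Quotient.isDomain _
      intro a b hab
      have h1 : y • e a = y • e b := by
        rw [← map_smul, ← map_smul]
        exact congrArg e hab
      rw [Algebra.smul_def, Algebra.smul_def] at h1
      refine e.injective (mul_left_cancel₀ ?_ h1)
      rwa [Ideal.Quotient.algebraMap_eq, Ne, Ideal.Quotient.eq_zero_iff_mem]
  · intro N₁ _ _ _ N₂ _ _ _ N₃ _ _ _ f g hf hg hfg h₁ h₃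
    exact extension _ _ _ (ModuleCat.ofHom f) (ModuleCat.ofHom g) ⟨hf, hg, hfg⟩ h₁ h₃

theorem ext_subsingleton_of_residue {Y : ModuleCat.{0} R} [Module.Finite R Y] {i : ℕ}
    (hk : Subsingleton (Abelian.Ext (residueModule R) Y i))
    (hsucc : ∀ N : ModuleCat.{0} R, Module.Finite R N → Subsingleton (Abelian.Ext N Y (i + 1)))
    (N : ModuleCat.{0} R) [Module.Finite R N] : Subsingleton (Abelian.Ext N Y i) := by
  induction N using finite_module_induction with
  | subsingleton N hN =>
    refine subsingleton_of_forall_eq 0 fun a => ?_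
    have : 𝟙 N = 0 := ModuleCat.hom_ext (LinearMap.ext fun _ => Subsingleton.elim _ _)
    rw [← extPull_id a, this, extPull_def, Abelian.Ext.mk₀_zero, Abelian.Ext.zero_comp]
  | residue => exact hk
  | regular N _ y hy hreg =>
    exact ext_subsingleton_of_regular hy (ShortExactPair.of_isSMulRegular hreg)
      (hsucc _ inferInstance)
  | extension N₁ N₂ N₃ f g hS h₁ h₃ =>
    refine subsingleton_of_forall_eq 0 fun b => ?_
    obtain ⟨c, rfl⟩ := hS.exists_extPull_eq b (Subsingleton.elim _ _)
    rw [Subsingleton.elim c 0, map_zero]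

/-- A bound on the injective dimension by the depth of the ring. -/
theorem ExtVanishAbove.le_depth {Y : ModuleCat.{0} R} [Module.Finite R Y] {r d : ℕ}
    (hY : ExtVanishAbove Y r) (hR : DepthGE (ModuleCat.of R R) d)
    (hR' : Nontrivial (Abelian.Ext (residueModule R) (ModuleCat.of R R) d)) :
    ExtVanishAbove Y d := by
  obtain ⟨ξ, hξ⟩ := exists_ne (0 : Abelian.Ext (residueModule R) (ModuleCat.of R R) d)
  have key : ∀ e, ExtVanishAbove Y (d + e) → ExtVanishAbove Y d := by
    intro e
    induction e with
    | zero => exact id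
    | succ e ih =>
      refine fun h => ih fun N hN i hi => ?_
      by_cases hi' : d + (e + 1) < i
      · exact h N hN i hi'
      obtain rfl : i = d + (e + 1) := by omega
      refine ext_subsingleton_of_residue (subsingleton_of_forall_eq 0 fun η => ?_)
        (fun N hN => h N hN _ (by omega)) N
      obtain ⟨β, rfl⟩ := exists_comp_eq_of_depthGE h hR hξ rfl η
      rw [Abelian.Ext.eq_zero_of_projective β, Abelian.Ext.comp_zero]
  exact key r fun N hN i hi => hY N hN i (by omega)

theorem ExtSurj.of_residue {Y Z : ModuleCat.{0} R} [Module.Finite R Z] (g : Y ⟶ Z) {i : ℕ}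
    (hk : ExtSurj g (residueModule R) i)
    (hs : ∀ N : ModuleCat.{0} R, Module.Finite R N → ExtSurj g N (i + 1))
    (hi : ∀ N : ModuleCat.{0} R, Module.Finite R N → ExtInj g N (i + 1))
    (N : ModuleCat.{0} R) [hN : Module.Finite R N] : ExtSurj g N i := by
  suffices H : Module.Finite R N → ExtSurj g N i from H hN
  induction N using finite_module_induction with
  | subsingleton N hN =>
    intro _ a
    have : 𝟙 N = 0 := ModuleCat.hom_ext (LinearMap.ext fun _ => Subsingleton.elim _ _)
    refine ⟨0, ?_⟩
    rw [map_zero, ← extPull_id a, this, extPull_def, Abelian.Ext.mk₀_zero, Abelian.Ext.zero_comp]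
  | residue => exact fun _ => hk
  | regular N _ y hy hreg =>
    exact fun _ => ExtSurj.of_regular g hy (ShortExactPair.of_isSMulRegular hreg)
      (hs _ inferInstance) (hi _ inferInstance)
  | extension N₁ N₂ N₃ f q hS h₁ h₃ =>
    intro hN₂ b
    have hN₃ : Module.Finite R N₃ := Module.Finite.of_surjective q.hom hS.surj
    have hN₁ : Module.Finite R N₁ := Module.Finite.of_injective f.hom hS.inj
    obtain ⟨a, ha⟩ := h₁ hN₁ (extPull f b)
    have ha0 : hS.del a = 0 := hi N₃ hN₃ (by
      rw [hS.extPush_del, ha, map_zero, hS.del_extPull])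
    obtain ⟨b', rfl⟩ := hS.exists_extPull_eq_of_del a ha0
    obtain ⟨c, hc⟩ := hS.exists_extPull_eq (b - extPush g b') (by
      rw [map_sub, ← ha, extPush_extPull, sub_self])
    obtain ⟨c', rfl⟩ := h₃ hN₃ c
    refine ⟨b' + extPull q c', ?_⟩
    rw [map_add, extPush_extPull, hc, add_sub_cancel]

theorem surjective_of_extSurj_residue {Y Z : ModuleCat.{0} R} [Module.Finite R Y]
    [Module.Finite R Z] {d : ℕ} (hR : DepthGE (ModuleCat.of R R) d) (hY : ExtVanishAbove Y d)
    (hZ : ExtVanishAbove Z d) (g : Y ⟶ Z) (hg : ExtSurj g (residueModule R) d) :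
    Function.Surjective g := by
  have key : ∀ (j : ℕ) (N : ModuleCat.{0} R) (_ : Module.Finite R N) (i : ℕ), i + j = d →
      DepthGE N j → ExtSurj g N i := by
    intro j
    induction j with
    | zero =>
      rintro N hN i rfl -
      refine ExtSurj.of_residue g hg (fun N hN a => ?_) (fun N hN a b _ => ?_) N
      · have := hZ N hN (i + 1) (by omega)
        exact ⟨0, Subsingleton.elim _ _⟩
      · have := hY N hN (i + 1) (by omega)
        exact Subsingleton.elim _ _
    | succ j ih =>
      intro N hN i hi hd
      obtain ⟨y, hy, C, q, hC, hS, hdC⟩ := exists_regular_of_depthGE hd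
      have := ext_subsingleton_of_depthGE hY hd (i := i + 1) (by omega)
      exact ExtSurj.of_regular g hy hS (ih C hC _ (by omega) hdC)
        fun a b _ => Subsingleton.elim _ _
  exact surjective_of_extSurj g (key d _ inferInstance 0 (zero_add d) hR)

theorem bijective_of_extSurj_residue {Y : ModuleCat.{0} R} [Module.Finite R Y]
    {d : ℕ} (hY : ExtVanishAbove Y d) (u : Y ⟶ Y)
    (hu : ∀ i ≤ d, ExtSurj u (residueModule R) i) :
    Function.Bijective u := by
  have key : ∀ (e i : ℕ), i + e = d + 1 → ∀ N : ModuleCat.{0} R, Module.Finite R N →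
      ExtSurj u N i ∧ ExtInj u N i := by
    intro e
    induction e with
    | zero =>
      intro i hi N hN
      have := hY N hN i (by omega)
      exact ⟨fun a => ⟨0, Subsingleton.elim _ _⟩, fun a b _ => Subsingleton.elim _ _⟩
    | succ e ih =>
      intro i hi N hN
      have hs := ExtSurj.of_residue u (hu i (by omega)) (fun N hN => (ih _ (by omega) N hN).1)
        (fun N hN => (ih _ (by omega) N hN).2) N
      exact ⟨hs, IsNoetherian.injective_of_surjective_endomorphism _ hs⟩
  have hs := surjective_of_extSurj u (key (d + 1) 0 (zero_add _) _ inferInstance).1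
  exact ⟨IsNoetherian.injective_of_surjective_endomorphism u.hom hs, hs⟩

end Devissage

section Retract

variable {R : Type} [CommRing R]

/-- A split surjection exhibits its source as the product of its target and its kernel. -/
def retractEquiv {A W : Type} [AddCommGroup A] [Module R A] [AddCommGroup W] [Module R W]
    (g : A →ₗ[R] W) (s : W →ₗ[R] A) (h : ∀ w, g (s w) = w) : A ≃ₗ[R] W × LinearMap.ker g where
  toFun x := (g x, ⟨x - s (g x), by rw [LinearMap.mem_ker, map_sub, h, sub_self]⟩)
  invFun z := s z.1 + z.2
  map_add' x y := Prod.ext (map_add g x y) (Subtype.ext (by simp; abel))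
  map_smul' r x := Prod.ext (map_smul g r x) (Subtype.ext (by simp [smul_sub]))
  left_inv x := by simp
  right_inv z := by
    have : g z.2 = 0 := z.2.2
    refine Prod.ext ?_ (Subtype.ext ?_) <;> simp [h, this]

theorem ExtVanishAbove.of_retract {Y Y' : ModuleCat.{0} R} {d : ℕ} (hY : ExtVanishAbove Y d)
    (i : Y' ⟶ Y) (r : Y ⟶ Y') (h : i ≫ r = 𝟙 Y') : ExtVanishAbove Y' d := fun N hN n hn => by
  have := hY N hN n hn
  refine subsingleton_of_forall_eq 0 fun a => ?_
  rw [← extPush_id a, ← h, extPush_comp, Subsingleton.elim (extPush i a) 0, map_zero]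

theorem DepthGE.of_retract [IsLocalRing R] {Y Y' : ModuleCat.{0} R} {d : ℕ} (hY : DepthGE Y d)
    (i : Y' ⟶ Y) (r : Y ⟶ Y') (h : i ≫ r = 𝟙 Y') : DepthGE Y' d := fun n hn => by
  have := hY n hn
  refine subsingleton_of_forall_eq 0 fun a => ?_
  rw [← extPush_id a, ← h, extPush_comp, Subsingleton.elim (extPush i a) 0, map_zero]

namespace ShortExactPair

variable {A B C : ModuleCat.{0} R} {f : A ⟶ B} {g : B ⟶ C}

theorem exists_hom_lift (h : ShortExactPair f g) {X : ModuleCat.{0} R} (φ : X ⟶ B)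
    (hφ : φ ≫ g = 0) : ∃ ψ : X ⟶ A, ψ ≫ f = φ := by
  obtain ⟨b, hb⟩ := h.exists_extPush_eq (Abelian.Ext.mk₀ φ) (by
    rw [extPush_def, Abelian.Ext.mk₀_comp_mk₀, hφ, Abelian.Ext.mk₀_zero])
  obtain ⟨ψ, rfl⟩ := (Abelian.Ext.mk₀_bijective _ _).2 b
  rw [extPush_def, Abelian.Ext.mk₀_comp_mk₀] at hb
  exact ⟨ψ, (Abelian.Ext.mk₀_bijective _ _).1 hb⟩

theorem extVanishAbove_middle (h : ShortExactPair f g) {d : ℕ} (hA : ExtVanishAbove A d)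
    (hC : ExtVanishAbove C d) : ExtVanishAbove B d := fun N hN i hi => by
  have := hA N hN i hi
  have := hC N hN i hi
  refine subsingleton_of_forall_eq 0 fun b => ?_
  obtain ⟨a, rfl⟩ := h.exists_extPush_eq b (Subsingleton.elim _ _)
  rw [Subsingleton.elim a 0, map_zero]

theorem extVanishAbove_left [IsLocalRing R] [IsNoetherianRing R] (h : ShortExactPair f g)
    [Module.Finite R A] {d : ℕ} (hB : ExtVanishAbove B d) (hC : ExtVanishAbove C d)
    (hR : DepthGE (ModuleCat.of R R) d)
    (hR' : Nontrivial (Abelian.Ext (residueModule R) (ModuleCat.of R R) d)) :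
    ExtVanishAbove A d := by
  refine ExtVanishAbove.le_depth (r := d + 1) (fun N hN i hi => ?_) hR hR'
  obtain ⟨i, rfl⟩ : ∃ i', i = i' + 1 := ⟨i - 1, by omega⟩
  have := hB N hN (i + 1) (by omega)
  have := hC N hN i (by omega)
  refine subsingleton_of_forall_eq 0 fun a => ?_
  obtain ⟨c, rfl⟩ := h.exists_codel_eq a (Subsingleton.elim _ _)
  rw [Subsingleton.elim c 0, map_zero]

end ShortExactPair

/-- A common summand `W` of `κ : K ⟶ X` splits off from a short exact sequence. -/
theorem ShortExactPair.ker_of_retract {W K X M : ModuleCat.{0} R} {κ : K ⟶ X} {ρ : X ⟶ M}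
    (h : ShortExactPair κ ρ) {a : W ⟶ K} {b : X ⟶ W} (hab : a ≫ κ ≫ b = 𝟙 W) :
    ShortExactPair
      (ModuleCat.ofHom (LinearMap.restrict (p := LinearMap.ker (κ ≫ b).hom)
        (q := LinearMap.ker b.hom) κ.hom fun _ hk => hk))
      (ModuleCat.ofHom (LinearMap.ker b.hom).subtype ≫ ρ) := by
  have hab' : ∀ w : W, b (κ (a w)) = w := fun w => ConcreteCategory.congr_hom hab w
  refine ⟨fun x y hxy => Subtype.ext (h.inj (congrArg Subtype.val hxy)), fun m => ?_, ?_⟩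
  · obtain ⟨x, rfl⟩ := h.surj m
    refine ⟨⟨x - κ (a (b x)), ?_⟩, ?_⟩
    · rw [LinearMap.mem_ker, map_sub]
      exact sub_eq_zero.mpr (hab' _).symm
    · refine (map_sub ρ.hom x (κ (a (b x)))).trans ?_
      have : ρ.hom (κ (a (b x))) = 0 := h.exact.apply_apply_eq_zero _
      rw [this, sub_zero]
  · rintro ⟨x, hx⟩
    constructor
    · intro hx0
      obtain ⟨k, rfl⟩ := (h.exact x).mp hx0
      exact ⟨⟨k, hx⟩, rfl⟩
    · rintro ⟨k, hk⟩
      obtain rfl : κ k.1 = x := congrArg Subtype.val hk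
      exact h.exact.apply_apply_eq_zero _

theorem exists_ker_retraction {W A : ModuleCat.{0} R} {s : W ⟶ A} {g : A ⟶ W} (h : s ≫ g = 𝟙 W) :
    ∃ r : A ⟶ ModuleCat.of R (LinearMap.ker g.hom),
      ModuleCat.ofHom (LinearMap.ker g.hom).subtype ≫ r = 𝟙 _ ∧
      r ≫ ModuleCat.ofHom (LinearMap.ker g.hom).subtype = 𝟙 A - g ≫ s ∧ s ≫ r = 0 := by
  have h' : ∀ w : W, g (s w) = w := fun w => ConcreteCategory.congr_hom h w
  refine ⟨ModuleCat.ofHom (LinearMap.snd R W _ ∘ₗ (retractEquiv g.hom s.hom h').toLinearMap),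
    ?_, ?_, ?_⟩
  · refine ModuleCat.hom_ext (LinearMap.ext fun x => Subtype.ext ?_)
    have hx : g.hom x.1 = 0 := x.2
    change x.1 - s.hom (g.hom x.1) = x.1
    rw [hx, map_zero, sub_zero]
  · rfl
  · refine ModuleCat.hom_ext (LinearMap.ext fun x => Subtype.ext ?_)
    change s.hom x - s.hom (g.hom (s.hom x)) = 0
    have : g.hom (s.hom x) = x := h' x
    rw [this, sub_self]

theorem not_equiv_and_equiv_prod [IsNoetherianRing R] {A B C : Type}
    [AddCommGroup A] [AddCommGroup B]
    [AddCommGroup C] [Module R A] [Module R B] [Module R C] [Nontrivial A] [Module.Finite R C]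
    (e : B ≃ₗ[R] C) (e' : B ≃ₗ[R] (A × C)) : False := by
  let f : C ≃ₗ[R] A × C := e.symm.trans e'
  have h := IsNoetherian.injective_of_surjective_endomorphism
    (LinearMap.snd R A C ∘ₗ f.toLinearMap) (Prod.snd_surjective.comp f.surjective)
  obtain ⟨a, ha⟩ := exists_ne (0 : A)
  have h1 : f.symm (a, 0) = f.symm 0 := h (by simp)
  exact ha (congrArg Prod.fst (f.symm.injective h1))

end Retract

section Approximation

variable {R : Type} [CommRing R] [IsLocalRing R] [IsNoetherianRing R]

/-- The properties of a canonical module `W` over a Cohen-Macaulay local ring of dimension `d`,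
in terms of `Abelian.Ext`. -/
structure CanonicalData (W : ModuleCat.{0} R) (d : ℕ) : Prop where
  finite : Module.Finite R W
  depth_ring : DepthGE (ModuleCat.of R R) d
  nontrivial_ring : Nontrivial (Abelian.Ext (residueModule R) (ModuleCat.of R R) d)
  vanish : ExtVanishAbove W d
  depth : DepthGE W d
  nontrivial : Nontrivial (Abelian.Ext (residueModule R) W d)
  exists_smul_eq : ∀ a b : Abelian.Ext (residueModule R) W d, a ≠ 0 → ∃ r : R, r • a = b

/-- The map `ι` vanishes on the Ext module from the residue field in degree `d`. -/
def ResidueExtZero {Y X : ModuleCat.{0} R} (ι : Y ⟶ X) (d : ℕ) : Prop :=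
  ∀ y : Abelian.Ext (residueModule R) Y d, extPush ι y = 0

/-- A short exact sequence with maximal Cohen-Macaulay middle term and left term of finite
injective dimension, in terms of `Abelian.Ext`. -/
structure ApproxData {Y X M : ModuleCat.{0} R} (ι : Y ⟶ X) (π : X ⟶ M) (d : ℕ) : Prop where
  seq : ShortExactPair ι π
  finite_left : Module.Finite R Y
  finite_middle : Module.Finite R X
  vanish : ExtVanishAbove Y d
  depth : DepthGE X d

theorem CanonicalData.exists_common_summand {W Y X : ModuleCat.{0} R} {d : ℕ}
    (hW : CanonicalData W d) [Module.Finite R Y] [Module.Finite R X] (hX : DepthGE X d)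
    (hY : ExtVanishAbove Y d) (ι : Y ⟶ X) (h : ¬ ResidueExtZero ι d) :
    ∃ (a : W ⟶ Y) (b : X ⟶ W), a ≫ ι ≫ b = 𝟙 W := by
  have := hW.finite
  obtain ⟨y, hy⟩ := not_forall.mp h
  have := hW.nontrivial
  obtain ⟨η, hη⟩ := exists_ne (0 : Abelian.Ext (residueModule R) W d)
  obtain ⟨β, hβ⟩ := exists_comp_eq_of_depthGE hW.vanish hX hy (add_zero d) η
  obtain ⟨b, rfl⟩ := (Abelian.Ext.mk₀_bijective _ _).2 β
  have hb : extPush (ι ≫ b) y = η := (extPush_comp ι b y).trans hβ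
  have hsurj : Function.Surjective (ι ≫ b) := by
    refine surjective_of_extSurj_residue hW.depth_ring hY hW.vanish _ fun a => ?_
    obtain ⟨r, rfl⟩ := hW.exists_smul_eq η a hη
    exact ⟨r • y, by rw [map_smul, hb]⟩
  have hS := ShortExactPair.ker (ι ≫ b) hsurj
  have hK := hS.extVanishAbove_left hY hW.vanish hW.depth_ring hW.nontrivial_ring
  obtain ⟨a, ha⟩ := hS.exists_lift (𝟙 W)
    (ext_subsingleton_of_depthGE hK hW.depth (by omega))
  exact ⟨a, b, ha⟩

theorem CanonicalData.residueExtZero_of_minimal {W Y X : ModuleCat.{0} R} {d : ℕ}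
    (hW : CanonicalData W d) [Nontrivial W] [Module.Finite R Y] [Module.Finite R X]
    (hX : DepthGE X d) (hY : ExtVanishAbove Y d) (ι : Y ⟶ X)
    (h : ¬ HasCommonSummandVia R ι.hom) : ResidueExtZero ι d := by
  by_contra hι
  obtain ⟨a, b, hab⟩ := hW.exists_common_summand hX hY ι hι
  have hab' : ∀ w : W, b (ι (a w)) = w := fun w => ConcreteCategory.congr_hom hab w
  refine h ⟨W, ModuleCat.of R (LinearMap.ker (b.hom ∘ₗ ι.hom)),
    ModuleCat.of R (LinearMap.ker b.hom), inferInstance,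
    retractEquiv (b.hom ∘ₗ ι.hom) a.hom hab', retractEquiv b.hom (ι.hom ∘ₗ a.hom) hab',
    LinearMap.restrict ι.hom fun y hy => hy, fun y => Prod.ext rfl (Subtype.ext ?_)⟩
  exact (map_sub ι.hom y (a (b (ι y)))).symm

namespace ApproxData

variable {Y X M : ModuleCat.{0} R} {ι : Y ⟶ X} {π : X ⟶ M} {d : ℕ}

theorem bijective_of_comp_eq (h : ApproxData ι π d) (hι : ResidueExtZero ι d) (φ : X ⟶ X)
    (hφ : φ ≫ π = π) : Function.Bijective φ := by
  have := h.finite_left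
  obtain ⟨t, ht⟩ := h.seq.exists_hom_lift (φ - 𝟙 X) (by
    rw [Preadditive.sub_comp, hφ, Category.id_comp, sub_self])
  have hu : Function.Bijective (𝟙 Y + ι ≫ t) := by
    refine bijective_of_extSurj_residue h.vanish _ fun i hi y => ⟨y, ?_⟩
    have : extPush ι y = 0 := by
      rcases hi.eq_or_lt with rfl | hi
      · exact hι y
      · have := h.depth i hi
        exact Subsingleton.elim _ _
    rw [extPush_add, extPush_id, extPush_comp, this, map_zero, add_zero]
  have hcomm : ∀ y, ι ((𝟙 Y + ι ≫ t) y) = φ (ι y) := fun y => by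
    refine ConcreteCategory.congr_hom (f := (𝟙 Y + ι ≫ t) ≫ ι) (g := ι ≫ φ) ?_ y
    rw [Preadditive.add_comp, Category.id_comp, Category.assoc, ht, Preadditive.comp_sub,
      Category.comp_id, add_sub_cancel]
  have hπ : ∀ x, π (φ x) = π x := fun x => ConcreteCategory.congr_hom hφ x
  refine ⟨(injective_iff_map_eq_zero φ.hom).mpr fun x hx => ?_, fun x => ?_⟩
  · obtain ⟨y, rfl⟩ := (h.seq.exact x).mp (by rw [← hπ, hx, map_zero])
    have h0 : ι ((𝟙 Y + ι ≫ t) y) = ι ((𝟙 Y + ι ≫ t) 0) := by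
      rw [hcomm, map_zero, map_zero]
      exact hx
    rw [hu.1 (h.seq.inj h0), map_zero]
  · obtain ⟨y, hy⟩ := (h.seq.exact (x - φ x)).mp (by rw [map_sub, hπ, sub_self])
    obtain ⟨y', rfl⟩ := hu.2 y
    refine ⟨x + ι y', ?_⟩
    rw [map_add, ← hcomm, hy, add_sub_cancel]

/-- Approximations that vanish on the top Ext module from the residue field are unique. -/
theorem unique {Y' X' : ModuleCat.{0} R} {ι' : Y' ⟶ X'} {π' : X' ⟶ M}
    (h : ApproxData ι π d) (hι : ResidueExtZero ι d)
    (h' : ApproxData ι' π' d) (hι' : ResidueExtZero ι' d) :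
    Nonempty (X ≃ₗ[R] X') ∧ Nonempty (Y ≃ₗ[R] Y') := by
  have := h.finite_left
  have := h'.finite_left
  have := h.finite_middle
  have := h'.finite_middle
  obtain ⟨φ, hφ⟩ := h'.seq.exists_lift π
    (ext_subsingleton_of_depthGE h'.vanish h.depth (by omega))
  obtain ⟨ψ, hψ⟩ := h.seq.exists_lift π'
    (ext_subsingleton_of_depthGE h.vanish h'.depth (by omega))
  have h1 := h.bijective_of_comp_eq hι (φ ≫ ψ) (by rw [Category.assoc, hψ, hφ])
  have h2 := h'.bijective_of_comp_eq hι' (ψ ≫ φ) (by rw [Category.assoc, hφ, hψ])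
  have hbij : Function.Bijective φ.hom := by
    refine ⟨fun x y hxy => h1.1 (congrArg ψ hxy), fun x => ?_⟩
    obtain ⟨z, hz⟩ := h2.2 x
    exact ⟨ψ z, hz⟩
  have hπ : ∀ x, π' (φ x) = π x := fun x => ConcreteCategory.congr_hom hφ x
  let e : X ≃ₗ[R] X' := LinearEquiv.ofBijective φ.hom hbij
  have hmap : Submodule.map (e : X →ₗ[R] X') (LinearMap.range ι.hom) = LinearMap.range ι'.hom := by
    ext x'
    constructor
    · rintro ⟨_, ⟨y, rfl⟩, rfl⟩
      exact (h'.seq.exact _).mp ((hπ _).trans (h.seq.exact.apply_apply_eq_zero y))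
    · rintro ⟨y', rfl⟩
      obtain ⟨x, hx⟩ := hbij.2 (ι' y')
      refine ⟨x, (h.seq.exact x).mp ?_, hx⟩
      rw [← hπ, ← h'.seq.exact.apply_apply_eq_zero y']
      exact congrArg π' hx
  exact ⟨⟨e⟩, ⟨(LinearEquiv.ofInjective ι.hom h.seq.inj).trans
    ((e.ofSubmodules _ _ hmap).trans (LinearEquiv.ofInjective ι'.hom h'.seq.inj).symm)⟩⟩

end ApproxData

end Approximation

section Comparison

variable {R : Type} [CommRing R] [IsLocalRing R] [IsNoetherianRing R]
  {W M₁ M₂ Y₁ X₁ Y₂ X₂ : ModuleCat.{0} R} {d : ℕ}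

theorem approx_dichotomy (hW : CanonicalData W d) {μ : W ⟶ M₁} {q : M₁ ⟶ M₂}
    (hq : ShortExactPair μ q)
    {ι₁ : Y₁ ⟶ X₁} {π₁ : X₁ ⟶ M₁} (h₁ : ApproxData ι₁ π₁ d) (hι₁ : ResidueExtZero ι₁ d)
    {ι₂ : Y₂ ⟶ X₂} {π₂ : X₂ ⟶ M₂} (h₂ : ApproxData ι₂ π₂ d) (hι₂ : ResidueExtZero ι₂ d) :
    (Nonempty (X₁ ≃ₗ[R] X₂) ∧ Nonempty ((W × Y₁) ≃ₗ[R] Y₂)) ∨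
      (Nonempty (X₁ ≃ₗ[R] (W × X₂)) ∧ Nonempty (Y₁ ≃ₗ[R] Y₂)) := by
  have := hW.finite
  have := h₁.finite_left
  have := h₁.finite_middle
  have hρ : Function.Surjective (π₁ ≫ q) := hq.surj.comp h₁.seq.surj
  have hκ := ShortExactPair.ker (π₁ ≫ q) hρ
  set K := ModuleCat.of R (LinearMap.ker (π₁ ≫ q).hom)
  set κ : K ⟶ X₁ := ModuleCat.ofHom (LinearMap.ker (π₁ ≫ q).hom).subtype
  obtain ⟨p, hp⟩ := hq.exists_hom_lift (κ ≫ π₁) (by rw [Category.assoc, hκ.comp_eq_zero])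
  obtain ⟨j, hj⟩ := hκ.exists_hom_lift ι₁ (by
    rw [← Category.assoc, h₁.seq.comp_eq_zero, Limits.zero_comp])
  have hp' : ∀ k, μ (p k) = π₁ (κ k) := fun k => ConcreteCategory.congr_hom hp k
  have hj' : ∀ y, κ (j y) = ι₁ y := fun y => ConcreteCategory.congr_hom hj y
  have hjp : ShortExactPair j p := by
    refine ⟨fun x y hxy => h₁.seq.inj ?_, fun w => ?_, fun k => ⟨fun hk => ?_, ?_⟩⟩
    · rw [← hj', ← hj', hxy]
    · obtain ⟨x, hx⟩ := h₁.seq.surj (μ w)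
      obtain ⟨k, rfl⟩ := (hκ.exact x).mp
        ((congrArg q hx).trans (hq.exact.apply_apply_eq_zero w))
      exact ⟨k, hq.inj ((hp' k).trans hx)⟩
    · obtain ⟨y, hy⟩ := (h₁.seq.exact (κ k)).mp (by rw [← hp', hk, map_zero])
      exact ⟨y, hκ.inj ((hj' y).trans hy)⟩
    · rintro ⟨y, rfl⟩
      refine hq.inj ?_
      rw [hp', hj', map_zero]
      exact h₁.seq.exact.apply_apply_eq_zero y
  have hKfin : Module.Finite R K := inferInstance
  have hKv : ExtVanishAbove K d := hjp.extVanishAbove_middle h₁.vanish hW.vanish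
  by_cases hs : ResidueExtZero κ d
  · left
    obtain ⟨⟨e⟩, ⟨e'⟩⟩ := ApproxData.unique ⟨hκ, hKfin, h₁.finite_middle, hKv, h₁.depth⟩ hs h₂ hι₂
    obtain ⟨s, hs⟩ := hjp.exists_lift (𝟙 W)
      (ext_subsingleton_of_depthGE h₁.vanish hW.depth (by omega))
    let eY : Y₁ ≃ₗ[R] LinearMap.ker p.hom := (LinearEquiv.ofInjective j.hom hjp.inj).trans
      (LinearEquiv.ofEq _ _ (LinearMap.exact_iff.mp hjp.exact).symm)
    let eK : K ≃ₗ[R] W × LinearMap.ker p.hom :=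
      retractEquiv p.hom s.hom fun w => ConcreteCategory.congr_hom hs w
    exact ⟨⟨e⟩, ⟨((LinearEquiv.refl R W).prodCongr eY).trans (eK.symm.trans e')⟩⟩
  · right
    obtain ⟨a, b, hab⟩ := hW.exists_common_summand h₁.depth hKv κ hs
    have hab₁ : (a ≫ κ) ≫ b = 𝟙 W := by rw [Category.assoc, hab]
    have hseq := hκ.ker_of_retract hab
    set Y' := ModuleCat.of R (LinearMap.ker (κ ≫ b).hom)
    set X' := ModuleCat.of R (LinearMap.ker b.hom)
    set iY : Y' ⟶ K := ModuleCat.ofHom (LinearMap.ker (κ ≫ b).hom).subtype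
    set iX : X' ⟶ X₁ := ModuleCat.ofHom (LinearMap.ker b.hom).subtype
    set ι' : Y' ⟶ X' := ModuleCat.ofHom (LinearMap.restrict κ.hom fun _ hk => hk)
    obtain ⟨rX, hrX⟩ : ∃ rX : X₁ ⟶ X', iX ≫ rX = 𝟙 X' := (exists_ker_retraction hab₁).imp
      fun _ h => h.1
    obtain ⟨rY, hrY, hrY', harY⟩ : ∃ rY : K ⟶ Y', iY ≫ rY = 𝟙 Y' ∧
      rY ≫ iY = 𝟙 K - (κ ≫ b) ≫ a ∧ a ≫ rY = 0 := exists_ker_retraction hab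
    have hι'X : ι' ≫ iX = iY ≫ κ := rfl
    have hiY : iY ≫ κ ≫ b = 0 := ModuleCat.hom_ext (LinearMap.ext fun k => k.2)
    obtain ⟨w₀, hw₀⟩ := @exists_ne _ hW.nontrivial (0 : Abelian.Ext (residueModule R) W d)
    have hbw : ∀ w : Abelian.Ext (residueModule R) W d,
        extPush b (extPush κ (extPush a w)) = w := fun w => by
      rw [← extPush_comp, ← extPush_comp, hab, extPush_id]
    have hκj : ∀ y : Abelian.Ext (residueModule R) Y₁ d, extPush κ (extPush j y) = 0 :=
      fun y => by rw [← extPush_comp, hj, hι₁]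
    have hpa : extPush p (extPush a w₀) ≠ 0 := fun h0 => hw₀ (by
      obtain ⟨y, hy⟩ := hjp.exists_extPush_eq _ h0
      rw [← hbw w₀, ← hy, hκj, map_zero])
    have hc : Function.Surjective (a ≫ p) := by
      refine surjective_of_extSurj_residue hW.depth_ring hW.vanish hW.vanish _ fun w => ?_
      obtain ⟨r, rfl⟩ := hW.exists_smul_eq _ w hpa
      exact ⟨r • w₀, by rw [map_smul, extPush_comp]⟩
    have hcinj : Function.Injective (a ≫ p) :=
      IsNoetherian.injective_of_surjective_endomorphism (a ≫ p).hom hc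
    have hι' : ResidueExtZero ι' d := fun z => by
      obtain ⟨r, hr⟩ := hW.exists_smul_eq _ (extPush p (extPush iY z)) hpa
      obtain ⟨y, hy⟩ := hjp.exists_extPush_eq (extPush iY z - r • extPush a w₀) (by
        rw [map_sub, map_smul, hr, sub_self])
      have h1 : extPush κ (extPush iY z) = r • extPush κ (extPush a w₀) := by
        rw [← map_smul, ← sub_eq_zero, ← map_sub, ← hy, hκj]
      have h2 : r • w₀ = 0 := by
        rw [← hbw w₀, ← map_smul, ← h1, ← extPush_comp, ← extPush_comp, hiY, extPush_zero]
      rw [← extPush_id (extPush ι' z), ← hrX, extPush_comp, ← extPush_comp ι' iX, hι'X,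
        extPush_comp, h1, ← map_smul, ← map_smul, h2, map_zero, map_zero, map_zero]
    obtain ⟨⟨e⟩, ⟨e'⟩⟩ := ApproxData.unique (ι := ι')
      ⟨hseq, inferInstance, inferInstance, hKv.of_retract iY rY hrY, h₁.depth.of_retract iX rX hrX⟩
      hι' h₂ hι₂
    have hθ : Function.Bijective (j ≫ rY).hom := by
      have hr : ∀ k, (rY k).1 = k - a (b (κ k)) := fun k => ConcreteCategory.congr_hom hrY' k
      refine ⟨(injective_iff_map_eq_zero (j ≫ rY).hom).mpr fun y hy => ?_, fun y' => ?_⟩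
      · have h0 : j y = a (b (κ (j y))) :=
          sub_eq_zero.mp ((hr (j y)).symm.trans (congrArg Subtype.val hy))
        have h1 : (a ≫ p) (b (κ (j y))) = (a ≫ p) 0 := by
          rw [map_zero]
          exact (congrArg p h0).symm.trans (hjp.exact.apply_apply_eq_zero y)
        refine hjp.inj ?_
        rw [h0, hcinj h1, map_zero, map_zero]
      · obtain ⟨w, hw⟩ := hc (p (iY y'))
        obtain ⟨y, hy⟩ := (hjp.exact (iY y' - a w)).mp (by
          rw [map_sub, ← hw]
          exact sub_self _)
        refine ⟨y, ?_⟩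
        have h1 : rY (iY y') = y' := ConcreteCategory.congr_hom hrY y'
        have h2 : rY (a w) = 0 := ConcreteCategory.congr_hom harY w
        have h3 : rY (j y) = y' := by rw [hy, map_sub, h1, h2, sub_zero]
        exact h3
    let eX : X₁ ≃ₗ[R] W × X' :=
      retractEquiv b.hom (a ≫ κ).hom fun w => ConcreteCategory.congr_hom hab₁ w
    exact ⟨⟨eX.trans ((LinearEquiv.refl R W).prodCongr e)⟩,
      ⟨(LinearEquiv.ofBijective _ hθ).trans e'⟩⟩

end Comparison

section Bridge

variable {R : Type} [CommRing R]

theorem HasFiniteInjDim.exists_extVanishAbove {Y : ModuleCat.{0} R} (h : HasFiniteInjDim R Y) :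
    ∃ r, ExtVanishAbove Y r := by
  obtain ⟨r, hr⟩ := h
  refine ⟨r, fun N _ i hi => ?_⟩
  have := hr N i hi
  exact (modExtEquiv i N Y).symm.subsingleton

variable [IsLocalRing R] {X W : ModuleCat.{0} R} {d : ℕ}

theorem depthGE_of_moduleDepth_eq (h : (moduleDepth R X : WithBot ℕ∞) = (d : ℕ)) :
    DepthGE X d := fun i hi => by
  by_contra hn
  have hnt : Nontrivial (ModExt R i (residueModule R) X) := by
    rw [← not_subsingleton_iff_nontrivial]
    intro hs
    exact hn (modExtEquiv i (residueModule R) X).symm.subsingleton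
  have hle : moduleDepth R X ≤ (i : ℕ∞) := sInf_le ⟨i, rfl, hnt⟩
  have hd : moduleDepth R X = (d : ℕ∞) := WithBot.coe_injective h
  rw [hd] at hle
  exact absurd (Nat.cast_le.mp hle) (by omega)

theorem nontrivial_ext_of_moduleDepth_eq (h : (moduleDepth R X : WithBot ℕ∞) = (d : ℕ)) :
    Nontrivial (Abelian.Ext (residueModule R) X d) := by
  have hd : moduleDepth R X = (d : ℕ∞) := WithBot.coe_injective h
  have hne : {n : ℕ∞ | ∃ m : ℕ, n = (m : ℕ∞) ∧
      Nontrivial (ModExt R m (residueModule R) X)}.Nonempty := by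
    rw [Set.nonempty_iff_ne_empty]
    intro h0
    have : moduleDepth R X = ⊤ := (congrArg sInf h0).trans sInf_empty
    rw [hd] at this
    exact ENat.natCast_ne_top d this
  obtain ⟨m, hm, hnt⟩ := csInf_mem hne
  obtain rfl : d = m := Nat.cast_injective (hd.symm.trans hm)
  exact (modExtEquiv d (residueModule R) X).symm.toEquiv.nontrivial

theorem IsCanonicalModule.exists_canonicalData (hR : IsCMLocalRing R)
    (h : IsCanonicalModule R W) :
    ∃ d : ℕ, ringKrullDim R = (d : ℕ) ∧ CanonicalData W d := by
  have := hR.1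
  obtain ⟨hfin, hinj, d, hd, ⟨e⟩, hi⟩ := h
  have hdep := hR.2.trans hd
  have hR₁ := depthGE_of_moduleDepth_eq hdep
  have hR₂ := nontrivial_ext_of_moduleDepth_eq hdep
  obtain ⟨r, hr⟩ := hinj.exists_extVanishAbove
  let e' : Abelian.Ext (residueModule R) W d ≃ₗ[R] IsLocalRing.ResidueField R :=
    (modExtEquiv d (residueModule R) W).symm.trans e
  refine ⟨d, hd, hfin, hR₁, hR₂, hr.le_depth hR₁ hR₂, fun i hid => ?_, e'.toEquiv.nontrivial,
    fun a b ha => ?_⟩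
  · have := hi i hid.ne
    exact (modExtEquiv i (residueModule R) W).symm.subsingleton
  · obtain ⟨r, hr⟩ := IsLocalRing.residue_surjective (R := R) (e' b * (e' a)⁻¹)
    refine ⟨r, e'.injective ?_⟩
    rw [map_smul, Algebra.smul_def, IsLocalRing.ResidueField.algebraMap_eq, hr,
      inv_mul_cancel_right₀ ((LinearEquiv.map_ne_zero_iff e').mpr ha)]

theorem CanonicalData.nontrivial_carrier (h : CanonicalData W d) : Nontrivial W := by
  rw [← not_subsingleton_iff_nontrivial]
  intro hs
  obtain ⟨a, ha⟩ := @exists_ne _ h.nontrivial (0 : Abelian.Ext (residueModule R) W d)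
  have : 𝟙 W = 0 := ModuleCat.hom_ext (LinearMap.ext fun _ => Subsingleton.elim _ _)
  exact ha (by rw [← extPush_id a, this, extPush_zero])

variable [IsNoetherianRing R] {M Y : ModuleCat.{0} R} {ι : Y →ₗ[R] X} {π : X →ₗ[R] M}

theorem IsMinMCMApprox.approxData (hW : CanonicalData W d) (hd : ringKrullDim R = (d : ℕ))
    (h : IsMinMCMApprox R M Y X ι π) :
    ApproxData (ModuleCat.ofHom ι) (ModuleCat.ofHom π) d := by
  obtain ⟨⟨-, hY, ⟨hX, hdepth⟩, hinj, hι, hπ, hex⟩, -⟩ := h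
  obtain ⟨r, hr⟩ := hinj.exists_extVanishAbove
  exact ⟨⟨hι, hπ, hex⟩, hY, hX, hr.le_depth hW.depth_ring hW.nontrivial_ring,
    depthGE_of_moduleDepth_eq (hdepth.trans hd)⟩

theorem IsMinMCMApprox.residueExtZero (hW : CanonicalData W d) (hd : ringKrullDim R = (d : ℕ))
    (h : IsMinMCMApprox R M Y X ι π) : ResidueExtZero (ModuleCat.ofHom ι) d := by
  have hA := h.approxData hW hd
  have := hW.nontrivial_carrier
  have := hA.finite_left
  have := hA.finite_middle
  exact hW.residueExtZero_of_minimal hA.depth hA.vanish _ h.2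

end Bridge

section MulExact

variable {R : Type} [CommRing R] {ω : Ideal R} {x : R}

/-- Multiplication by `x ∈ ω`, as a map from `ω` to `ω ^ 2`. -/
def mulIntoSquare (hx : x ∈ ω) : ω →ₗ[R] ↥(ω ^ 2) where
  toFun w := ⟨x * w, by rw [pow_two]; exact Ideal.mul_mem_mul hx w.2⟩
  map_add' a b := Subtype.ext (mul_add x a b)
  map_smul' r a := Subtype.ext (mul_left_comm x r a)

theorem shortExactPair_mulIntoSquare (hx : x ∈ ω) (hreg : x ∈ nonZeroDivisors R) :
    ShortExactPair (B := ModuleCat.of R ↥(ω ^ 2)) (C := qmod R (ω ^ 2) (Ideal.span {x} * ω))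
      (ModuleCat.ofHom (mulIntoSquare hx)) (ModuleCat.ofHom (Submodule.mkQ _)) where
  inj a b hab := Subtype.ext
    ((mul_cancel_left_mem_nonZeroDivisors hreg).mp (congrArg Subtype.val hab))
  surj := Submodule.mkQ_surjective _
  exact z := by
    refine (Submodule.Quotient.mk_eq_zero _).trans ?_
    rw [Submodule.mem_comap, Submodule.subtype_apply, Ideal.mem_span_singleton_mul]
    constructor
    · rintro ⟨w, hw, hz⟩
      exact ⟨⟨w, hw⟩, Subtype.ext hz⟩
    · rintro ⟨w, rfl⟩
      exact ⟨w.1, w.2, rfl⟩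

end MulExact

theorem stmt8 (R : Type) [CommRing R] [IsLocalRing R]
    (hCM : IsCMLocalRing R) (hGG : IsGenericallyGorenstein R)
    (ω : Ideal R) (hω : IsCanonicalIdeal R ω)
    (x : R) (hxω : x ∈ ω) (hxreg : x ∈ nonZeroDivisors R)
    (Y₁ X₁ : ModuleCat R) (ι₁ : Y₁ →ₗ[R] X₁) (π₁ : X₁ →ₗ[R] ModuleCat.of R ↥(ω ^ 2))
    (h₁ : IsMinMCMApprox R (ModuleCat.of R ↥(ω ^ 2)) Y₁ X₁ ι₁ π₁)
    (Y₂ X₂ : ModuleCat R) (ι₂ : Y₂ →ₗ[R] X₂) (π₂ : X₂ →ₗ[R] qmod R (ω ^ 2) (Ideal.span {x} * ω))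
    (h₂ : IsMinMCMApprox R (qmod R (ω ^ 2) (Ideal.span {x} * ω)) Y₂ X₂ ι₂ π₂) :
    ((Nonempty (X₁ ≃ₗ[R] X₂) ∧ Nonempty ((↥ω × Y₁) ≃ₗ[R] Y₂)) ∨ (Nonempty (X₁ ≃ₗ[R] (↥ω × X₂)) ∧ Nonempty (Y₁ ≃ₗ[R] Y₂))) ∧ ¬ ((Nonempty (X₁ ≃ₗ[R] X₂) ∧ Nonempty ((↥ω × Y₁) ≃ₗ[R] Y₂)) ∧ (Nonempty (X₁ ≃ₗ[R] (↥ω × X₂)) ∧ Nonempty (Y₁ ≃ₗ[R] Y₂))) := by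
  have := hCM.1
  obtain ⟨d, hd, hW⟩ := IsCanonicalModule.exists_canonicalData hCM hω
  have hA₂ := h₂.approxData hW hd
  refine ⟨approx_dichotomy hW (shortExactPair_mulIntoSquare hxω hxreg) (h₁.approxData hW hd)
    (h₁.residueExtZero hW hd) hA₂ (h₂.residueExtZero hW hd), ?_⟩
  rintro ⟨⟨⟨e⟩, -⟩, ⟨e'⟩, -⟩
  have : Nontrivial ω := hW.nontrivial_carrier
  have := hA₂.finite_middle
  exact not_equiv_and_equiv_prod e e'
end
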